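/- Let n ≥ 2, let q ≥ 7 be a prime power with q ∉ {8,9,16,25,27,49}, and let c be a code word of C_{n-1}(n,q) with θ_{n-1} < wt(c) ≤ min{(3q−6)θ_{n-2}+2, B_{n,q}}. Then there exists a 2-secant to supp(c). -/

import Mathlib

open scoped Classical

noncomputable section

namespace PGCode

open Projectivization

/-- The points of `PG(n, q)`, where the field `F` has order `q`. -/
abbrev Pt (F : Type) [Field F] (n : ℕ) := Projectivization F (Fin (n + 1) → F)

variable {F : Type} [Field F]

/-- A point of `PG(n,q)` lies in the projective subspace determined by a linear subspace `W`. -/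
def ptIn {n : ℕ} (P : Pt F n) (W : Submodule F (Fin (n + 1) → F)) : Prop :=
  Projectivization.submodule P ≤ W

/-- The set of points of the projective subspace determined by a linear subspace `W`. -/
def ptsIn {n : ℕ} (W : Submodule F (Fin (n + 1) → F)) : Set (Pt F n) :=
  {P | ptIn P W}

/-- The incidence vector (over `F_p = ZMod p`) of the projective subspace determined by `W`. -/
def incVec (p : ℕ) {n : ℕ} (W : Submodule F (Fin (n + 1) → F)) : Pt F n → ZMod p :=
  fun P => if ptIn P W then (1 : ZMod p) else 0

/-- The code `C_{n-1}(n,q)`: the `F_p`-span of the incidence vectors of all hyperplanes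
(projective dimension `n-1`, i.e. linear dimension `n`). -/
def code (F : Type) [Field F] (p n : ℕ) : Submodule (ZMod p) (Pt F n → ZMod p) :=
  Submodule.span (ZMod p)
    {v | ∃ W : Submodule F (Fin (n + 1) → F), Module.finrank F W = n ∧ v = incVec p W}

/-- The support of a word. -/
def supp {p n : ℕ} (v : Pt F n → ZMod p) : Set (Pt F n) := {P | v P ≠ 0}

/-- The weight of a word. -/
def wt {p n : ℕ} (v : Pt F n → ZMod p) : ℕ := (supp v).ncard

/-- The weight of the restriction of a word to the subspace determined by `W`. -/
def wtRes {p n : ℕ} (c : Pt F n → ZMod p) (W : Submodule F (Fin (n + 1) → F)) : ℕ :=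
  (ptsIn W ∩ supp c).ncard

/-- `θ_m = (q^(m+1) - 1)/(q - 1)`, with `θ_m = 0` for `m < 0`. -/
def theta (q : ℕ) (m : ℤ) : ℕ :=
  if m < 0 then 0 else ∑ i ∈ Finset.range (m.toNat + 1), q ^ i

/-- The bound `B_{n,q}` from the paper. -/
def B (n q : ℕ) : ℝ :=
  if q < 7 ∨ q = 8 ∨ q = 9 ∨ q = 16 ∨ q = 25 ∨ q = 27 ∨ q = 49 then
    2 * (q : ℝ) ^ (n - 1)
  else if q = 7 ∨ q = 11 ∨ q = 13 ∨ q = 17 then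
    (3 * q - Real.sqrt (6 * q) - 1 / 2) * (q : ℝ) ^ (n - 2)
  else if q = 19 ∨ q = 121 then
    (3 * q - Real.sqrt (6 * q) + 9 / 2) * (q : ℝ) ^ (n - 2)
  else if q = 29 ∨ q = 31 ∨ q = 32 then
    (4 * q - 4 * Real.sqrt q - 25 / 2) * (q : ℝ) ^ (n - 2)
  else
    (4 * q - Real.sqrt (8 * q) - 33 / 2) * (q : ℝ) ^ (n - 2)

/-- A line of `PG(n,q)`: a linear subspace of dimension `2`. -/
def IsLine {n : ℕ} (l : Submodule F (Fin (n + 1) → F)) : Prop := Module.finrank F l = 2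

/-- A plane of `PG(n,q)`: a linear subspace of dimension `3`. -/
def IsPlane {n : ℕ} (W : Submodule F (Fin (n + 1) → F)) : Prop := Module.finrank F W = 3

/-- The line `l` is an `α`-secant to `supp c`. -/
def secant {p n : ℕ} (c : Pt F n → ZMod p) (l : Submodule F (Fin (n + 1) → F)) (α : ℕ) : Prop :=
  IsLine l ∧ (ptsIn l ∩ supp c).ncard = α

/-- The restriction of `c` to the plane `W` is a linear combination of at most two lines of `W`. -/
def TwoLineComb (p : ℕ) {n : ℕ} (c : Pt F n → ZMod p) (W : Submodule F (Fin (n + 1) → F)) :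
    Prop :=
  ∃ l₁ l₂ : Submodule F (Fin (n + 1) → F), IsLine l₁ ∧ IsLine l₂ ∧ l₁ ≤ W ∧ l₂ ≤ W ∧
    ∃ a b : ZMod p, ∀ P : Pt F n, ptIn P W → c P = a * incVec p l₁ P + b * incVec p l₂ P

/-- Type `T^△`: the restriction of `c` to the plane `W` is a linear combination (with nonzero
coefficients) of three nonconcurrent lines of `W`. -/
def TypeTri (p : ℕ) {n : ℕ} (c : Pt F n → ZMod p) (W : Submodule F (Fin (n + 1) → F)) : Prop :=
  ∃ l₁ l₂ l₃ : Submodule F (Fin (n + 1) → F),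
    IsLine l₁ ∧ IsLine l₂ ∧ IsLine l₃ ∧ l₁ ≤ W ∧ l₂ ≤ W ∧ l₃ ≤ W ∧
    l₁ ≠ l₂ ∧ l₁ ≠ l₃ ∧ l₂ ≠ l₃ ∧
    (¬ ∃ P : Pt F n, ptIn P l₁ ∧ ptIn P l₂ ∧ ptIn P l₃) ∧
    ∃ a₁ a₂ a₃ : ZMod p, a₁ ≠ 0 ∧ a₂ ≠ 0 ∧ a₃ ≠ 0 ∧
      ∀ P : Pt F n, ptIn P W →
        c P = a₁ * incVec p l₁ P + a₂ * incVec p l₂ P + a₃ * incVec p l₃ P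

/-- Type `T^★`: the restriction of `c` to the plane `W` is a linear combination (with nonzero
coefficients) of three distinct concurrent lines of `W`. -/
def TypeStar (p : ℕ) {n : ℕ} (c : Pt F n → ZMod p) (W : Submodule F (Fin (n + 1) → F)) : Prop :=
  ∃ l₁ l₂ l₃ : Submodule F (Fin (n + 1) → F),
    IsLine l₁ ∧ IsLine l₂ ∧ IsLine l₃ ∧ l₁ ≤ W ∧ l₂ ≤ W ∧ l₃ ≤ W ∧
    l₁ ≠ l₂ ∧ l₁ ≠ l₃ ∧ l₂ ≠ l₃ ∧
    (∃ P : Pt F n, ptIn P l₁ ∧ ptIn P l₂ ∧ ptIn P l₃) ∧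
    ∃ a₁ a₂ a₃ : ZMod p, a₁ ≠ 0 ∧ a₂ ≠ 0 ∧ a₃ ≠ 0 ∧
      ∀ P : Pt F n, ptIn P W →
        c P = a₁ * incVec p l₁ P + a₂ * incVec p l₂ P + a₃ * incVec p l₃ P

/-- The base code word `c₀` of the `T^odd` construction on `PG(2,p)`:
`c₀(0,1,a) = a`, `c₀(1,0,b) = b`, `c₀(1,1,c) = -c`, and `c₀ = 0` elsewhere. -/
def oddBase (p : ℕ) [Fact p.Prime] : Pt (ZMod p) 2 → ZMod p := fun P =>
  if P.rep 0 = 0 ∧ P.rep 1 ≠ 0 then P.rep 2 / P.rep 1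
  else if P.rep 1 = 0 ∧ P.rep 0 ≠ 0 then P.rep 2 / P.rep 0
  else if P.rep 0 = P.rep 1 ∧ P.rep 0 ≠ 0 then -(P.rep 2 / P.rep 0)
  else 0

/-- The line `m : X₀ = 0` of `PG(2,p)`. -/
def lineM1 (p : ℕ) [Fact p.Prime] : Submodule (ZMod p) (Fin 3 → ZMod p) :=
  LinearMap.ker (LinearMap.proj 0 : (Fin 3 → ZMod p) →ₗ[ZMod p] ZMod p)

/-- The line `m' : X₁ = 0` of `PG(2,p)`. -/
def lineM2 (p : ℕ) [Fact p.Prime] : Submodule (ZMod p) (Fin 3 → ZMod p) :=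
  LinearMap.ker (LinearMap.proj 1 : (Fin 3 → ZMod p) →ₗ[ZMod p] ZMod p)

/-- The line `m'' : X₀ = X₁` of `PG(2,p)`. -/
def lineM3 (p : ℕ) [Fact p.Prime] : Submodule (ZMod p) (Fin 3 → ZMod p) :=
  LinearMap.ker ((LinearMap.proj 0 : (Fin 3 → ZMod p) →ₗ[ZMod p] ZMod p) - LinearMap.proj 1)

/-- The code word `d = (γ c₀ + λ m + λ' m' + λ'' m'')^π` of the `T^odd` construction, where the
collineation `π` of `PG(2,p)` is the inverse of the homography induced by the linear
equivalence `g`. -/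
def oddWord (p : ℕ) [Fact p.Prime] (g : (Fin 3 → ZMod p) ≃ₗ[ZMod p] (Fin 3 → ZMod p))
    (γ lam lam' lam'' : ZMod p) : Pt (ZMod p) 2 → ZMod p := fun P =>
  γ * oddBase p (Projectivization.map g.toLinearMap g.injective P) +
    lam * incVec p (lineM1 p) (Projectivization.map g.toLinearMap g.injective P) +
    lam' * incVec p (lineM2 p) (Projectivization.map g.toLinearMap g.injective P) +
    lam'' * incVec p (lineM3 p) (Projectivization.map g.toLinearMap g.injective P)

/-- The semilinear embedding of `PG(2,p)` onto the plane of `PG(n,q)` spanned by the linearly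
independent vectors `b 0, b 1, b 2`, relative to the field embedding `σ : F_p → F`. -/
def planeEmbed {n : ℕ} {p : ℕ} [Fact p.Prime] (σ : ZMod p →+* F)
    (b : Fin 3 → (Fin (n + 1) → F)) (hb : LinearIndependent F b) :
    Pt (ZMod p) 2 → Pt F n := fun P =>
  Projectivization.mk F (∑ i, σ (P.rep i) • b i) (by
    intro hzero
    have h0 : ∀ i ∈ Finset.univ, σ (P.rep i) = 0 :=
      linearIndependent_iff'.mp hb Finset.univ (fun i => σ (P.rep i)) hzero
    have h1 : P.rep = 0 := funext fun i => σ.injective (by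
      simp only [Pi.zero_apply, map_zero]; exact h0 i (Finset.mem_univ i))
    exact P.rep_nonzero h1)

/-- Type `T^odd`: this requires `q = p` to be prime (`|F| = p`), and `c` restricted to the plane
`W` (spanned by the frame `b`) must coincide, via a semilinear identification of `W` with
`PG(2,p)`, with a code word `d` of the `T^odd` construction. -/
def TypeOdd (p : ℕ) [Fact p.Prime] [Fintype F] {n : ℕ} (c : Pt F n → ZMod p)
    (W : Submodule F (Fin (n + 1) → F)) : Prop :=
  Fintype.card F = p ∧
  ∃ (σ : ZMod p →+* F) (b : Fin 3 → (Fin (n + 1) → F)) (hb : LinearIndependent F b),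
    Submodule.span F (Set.range b) = W ∧
    ∃ (g : (Fin 3 → ZMod p) ≃ₗ[ZMod p] (Fin 3 → ZMod p)) (γ lam lam' lam'' : ZMod p), γ ≠ 0 ∧
      ∀ Q : Pt (ZMod p) 2, c (planeEmbed σ b hb Q) = oddWord p g γ lam lam' lam'' Q

/-- The list of plane types `T_0, T_{q+1}, T_{2q}, T_{2q+1}, T^odd, T^△, T^★`. -/
inductive PlaneT : Type where
  | T0 | Tq1 | T2q | T2q1 | Todd | Ttri | Tstar
deriving DecidableEq

/-- The restriction of `c` to the plane `W` is a code word of the given type. -/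
def PlaneIsType (p q : ℕ) [Fact p.Prime] [Fintype F] {n : ℕ} (c : Pt F n → ZMod p)
    (W : Submodule F (Fin (n + 1) → F)) : PlaneT → Prop
  | .T0 => TwoLineComb p c W ∧ wtRes c W = 0
  | .Tq1 => TwoLineComb p c W ∧ wtRes c W = q + 1
  | .T2q => TwoLineComb p c W ∧ wtRes c W = 2 * q
  | .T2q1 => TwoLineComb p c W ∧ wtRes c W = 2 * q + 1
  | .Todd => TypeOdd p c W
  | .Ttri => TypeTri p c W
  | .Tstar => TypeStar p c W

/-- The plane `W` is of type `𝒯`. -/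
def TypeT (p q : ℕ) [Fact p.Prime] [Fintype F] {n : ℕ} (c : Pt F n → ZMod p)
    (W : Submodule F (Fin (n + 1) → F)) : Prop :=
  IsPlane W ∧ ∃ t : PlaneT, PlaneIsType p q c W t

/-- The plane `W` is of type `𝒪`. -/
def TypeO (p q : ℕ) [Fact p.Prime] [Fintype F] {n : ℕ} (c : Pt F n → ZMod p)
    (W : Submodule F (Fin (n + 1) → F)) : Prop :=
  IsPlane W ∧ ¬ TypeT p q c W

/-- The restriction of `c` to the `k`-space `Sp` (linear dimension `k+1`) is of type `t`:
there is a `(k-3)`-space `κ ⊆ Sp` on which `c` is a scalar multiple of the all-one function,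
a plane `π ⊆ Sp` of type `t` disjoint from `κ`, and `c P = c (⟨κ, P⟩ ∩ π)` for every point
`P` of `Sp` outside `κ`. -/
def SpaceIsType (p q : ℕ) [Fact p.Prime] [Fintype F] {n : ℕ} (c : Pt F n → ZMod p)
    (Sp : Submodule F (Fin (n + 1) → F)) (k : ℕ) (t : PlaneT) : Prop :=
  Module.finrank F Sp = k + 1 ∧
  ∃ κ : Submodule F (Fin (n + 1) → F), Module.finrank F κ = k - 2 ∧ κ ≤ Sp ∧
    (∃ a : ZMod p, ∀ P : Pt F n, ptIn P κ → c P = a) ∧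
    ∃ π : Submodule F (Fin (n + 1) → F), IsPlane π ∧ π ≤ Sp ∧ π ⊓ κ = ⊥ ∧
      PlaneIsType p q c π t ∧
      ∀ P : Pt F n, ptIn P Sp → ¬ ptIn P κ →
        ∃ Q : Pt F n, ptIn Q π ∧
          Projectivization.submodule Q ≤ κ ⊔ Projectivization.submodule P ∧ c P = c Q


section Moments

open Polynomial

/-- The power moments of the rows of `g` are polynomials in the row index `y`, the `k`-th one
being of degree at most `k`. -/
def HasMoments [Fintype F] (g : F → F → F) : Prop :=
  ∃ M : ℕ → F[X], ∀ k, (M k).natDegree ≤ k ∧ ∀ y, (M k).eval y = ∑ x, g x y * x ^ k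

/-- The number of nonzero entries in row `y` of `g`. -/
def rowWt [Fintype F] (g : F → F → F) (y : F) : ℕ := (Finset.univ.filter fun x => g x y ≠ 0).card

theorem hasMoments_zero [Fintype F] : HasMoments (fun _ _ : F => (0 : F)) :=
  ⟨0, fun k => by simp⟩

theorem HasMoments.add [Fintype F] {g g' : F → F → F} (hg : HasMoments g) (hg' : HasMoments g') :
    HasMoments (fun x y => g x y + g' x y) := by
  obtain ⟨M, hM⟩ := hg
  obtain ⟨M', hM'⟩ := hg'
  refine ⟨fun k => M k + M' k, fun k => ⟨?_, fun y => ?_⟩⟩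
  · exact (natDegree_add_le _ _).trans (max_le (hM k).1 (hM' k).1)
  · simp [(hM k).2, (hM' k).2, add_mul, Finset.sum_add_distrib]

theorem HasMoments.const_mul [Fintype F] {g : F → F → F} (hg : HasMoments g) (a : F) :
    HasMoments (fun x y => a * g x y) := by
  obtain ⟨M, hM⟩ := hg
  refine ⟨fun k => C a * M k, fun k => ⟨?_, fun y => ?_⟩⟩
  · exact (natDegree_C_mul_le _ _).trans (hM k).1
  · simp [(hM k).2, Finset.mul_sum, mul_assoc]

theorem hasMoments_one [Fintype F] : HasMoments (fun _ _ : F => (1 : F)) :=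
  ⟨fun k => C (∑ x : F, x ^ k), fun k => ⟨(natDegree_C _).trans_le (Nat.zero_le k), fun y => by
    rw [eval_C]; simp⟩⟩

theorem hasMoments_affine_pow [Fintype F] (a b d : F) :
    HasMoments (fun x y : F => (x * a + (b + y * d)) ^ (Fintype.card F - 1)) := by
  set m := Fintype.card F - 1 with hm
  refine ⟨fun k => ∑ j ∈ Finset.range (m + 1),
    C (a ^ j * (m.choose j : F) * ∑ x : F, x ^ (j + k)) * (C b + X * C d) ^ (m - j),
    fun k => ⟨?_, fun y => ?_⟩⟩
  · refine natDegree_sum_le_of_forall_le _ _ fun j _ => ?_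
    by_cases hj : j + k < m
    · rw [FiniteField.sum_pow_lt_card_sub_one F _ hj]
      simp
    · refine (natDegree_C_mul_le _ _).trans (natDegree_pow_le.trans ?_)
      have h1 : (C b + X * C d : F[X]).natDegree ≤ 1 := by compute_degree
      calc (m - j) * (C b + X * C d : F[X]).natDegree ≤ (m - j) * 1 := by gcongr
        _ ≤ k := by omega
  · rw [eval_finsetSum]
    calc _ = ∑ j ∈ Finset.range (m + 1), ∑ x : F,
          a ^ j * (m.choose j : F) * x ^ (j + k) * (b + y * d) ^ (m - j) := by
          simp only [eval_mul, eval_C, eval_pow, eval_add, eval_X, Finset.sum_mul, Finset.mul_sum]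
      _ = _ := by
          rw [Finset.sum_comm]
          refine Finset.sum_congr rfl fun x _ => ?_
          beta_reduce
          rw [add_pow (x * a), Finset.sum_mul]
          refine Finset.sum_congr rfl fun j _ => ?_
          ring

theorem natDegree_det_hankel_le (M : ℕ → F[X]) (hM : ∀ k, (M k).natDegree ≤ k) (s : ℕ) :
    (Matrix.of fun i j : Fin s => M (i + j)).det.natDegree ≤ s * (s - 1) := by
  rw [Matrix.det_apply]
  refine natDegree_sum_le_of_forall_le _ _ fun σ _ => ?_
  have h1 : (∏ i : Fin s, M ((σ i : ℕ) + (i : ℕ))).natDegree ≤ s * (s - 1) := by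
    refine (natDegree_prod_le _ _).trans ((Finset.sum_le_sum fun i _ => hM _).trans ?_)
    rw [Finset.sum_add_distrib, Equiv.sum_comp σ (fun i : Fin s => (i : ℕ)), Fin.sum_univ_eq_sum_range
      (fun i => i), ← two_mul, mul_comm, Finset.sum_range_id_mul_two]
  rcases Int.units_eq_one_or (Equiv.Perm.sign σ) with h | h <;> simpa [h] using h1

theorem pow_dvd_det_of_rows {s r : ℕ} (A : Matrix (Fin s) (Fin s) F[X]) (P : F[X])
    (hA : ∀ i j : Fin s, r ≤ (i : ℕ) → P ∣ A i j) : P ^ (s - r) ∣ A.det := by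
  rw [Matrix.det_apply']
  refine Finset.dvd_sum fun σ _ => Dvd.dvd.mul_left ?_ _
  have h1 : P ^ (s - r) ∣ ∏ i : Fin s, (if r ≤ ((σ i : Fin s) : ℕ) then P else 1) := by
    rw [Equiv.prod_comp σ (fun i : Fin s => if r ≤ (i : ℕ) then P else 1),
      Fin.prod_univ_eq_prod_range (fun i => if r ≤ i then P else 1), Finset.prod_ite]
    simp only [Finset.prod_const_one, mul_one, Finset.prod_const]
    apply pow_dvd_pow
    have : Finset.Ico r s ⊆ (Finset.range s).filter (fun i => r ≤ i) := by
      intro i; simp; tauto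
    simpa using Finset.card_le_card this
  refine h1.trans (Finset.prod_dvd_prod_of_dvd _ _ fun i _ => ?_)
  split_ifs with h
  · exact hA _ _ h
  · exact one_dvd _

theorem det_hankel_eval_ne_zero [Fintype F] {g : F → F → F} {M : ℕ → F[X]}
    (hM : ∀ k y, (M k).eval y = ∑ x, g x y * x ^ k) (y : F) :
    (Matrix.of fun i j : Fin (rowWt g y) => M (i + j)).det.eval y ≠ 0 := by
  set N := Finset.univ.filter fun x => g x y ≠ 0 with hN
  let e : Fin (rowWt g y) ≃ N := N.equivFin.symm
  let v : Fin (rowWt g y) → F := fun i => (e i : F)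
  have hv : Function.Injective v := Subtype.val_injective.comp e.injective
  have key : ((Matrix.of fun i j : Fin (rowWt g y) => M (i + j)).map (eval y)) =
      (Matrix.vandermonde v).transpose * Matrix.diagonal (fun i => g (v i) y) *
        Matrix.vandermonde v := by
    ext i j
    rw [Matrix.mul_assoc, Matrix.mul_apply]
    simp only [Matrix.map_apply, Matrix.of_apply, hM, Matrix.transpose_apply,
      Matrix.vandermonde_apply, Matrix.diagonal_mul]
    rw [← Finset.sum_filter_of_ne (p := fun x => g x y ≠ 0)
      (fun x _ h h0 => h (by simp [h0])), ← hN, ← Finset.sum_coe_sort, ← Equiv.sum_comp e]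
    refine Finset.sum_congr rfl fun x _ => ?_
    simp only [v]; ring
  have h2 : (Matrix.of fun i j : Fin (rowWt g y) => M (i + j)).det.eval y =
      ((Matrix.of fun i j : Fin (rowWt g y) => M (i + j)).map (eval y)).det := by
    rw [← coe_evalRingHom, RingHom.map_det]; rfl
  rw [h2, key, Matrix.det_mul, Matrix.det_mul, Matrix.det_transpose, Matrix.det_diagonal]
  have h3 := Matrix.det_vandermonde_ne_zero_iff.mpr hv
  refine mul_ne_zero (mul_ne_zero h3 ?_) h3
  refine Finset.prod_ne_zero_iff.mpr fun i _ => ?_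
  exact (Finset.mem_filter.mp (e i).2).2

theorem pow_dvd_det_hankel [Fintype F] {g : F → F → F} {M : ℕ → F[X]}
    (hM : ∀ k y, (M k).eval y = ∑ x, g x y * x ^ k) (y : F) (s : ℕ) :
    (X - C y) ^ (s - rowWt g y) ∣ (Matrix.of fun i j : Fin s => M (i + j)).det := by
  set N := Finset.univ.filter fun x => g x y ≠ 0 with hN
  set r := rowWt g y with hr
  set G : F[X] := ∏ x ∈ N, (X - C x) with hG
  have hGm : G.Monic := monic_prod_of_monic _ _ fun x _ => monic_X_sub_C x
  have hGd : G.natDegree = r := by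
    rw [hG, natDegree_prod_of_monic _ _ fun x _ => monic_X_sub_C x]; simp [hr, rowWt, hN]
  let P : Fin s → F[X] := fun i => if r ≤ (i : ℕ) then X ^ ((i : ℕ) - r) * G else X ^ (i : ℕ)
  have hPm : ∀ i, (P i).Monic := fun i => by
    simp only [P]; split_ifs
    · exact (monic_X_pow _).mul hGm
    · exact monic_X_pow _
  have hPd : ∀ i, (P i).natDegree = i := fun i => by
    simp only [P]; split_ifs with h
    · rw [(monic_X_pow _).natDegree_mul hGm, hGd, natDegree_X_pow]; omega
    · simp
  have hdet : (Matrix.of fun i j : Fin s => (P i).coeff j).det = 1 := by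
    rw [← Matrix.det_transpose]
    exact Matrix.det_matrixOfPolynomials P hPd hPm
  set H : Matrix (Fin s) (Fin s) F[X] := Matrix.of fun i j : Fin s => M (i + j) with hH
  set A : Matrix (Fin s) (Fin s) F[X] := (Matrix.of fun i j : Fin s => (P i).coeff j).map C with hA
  have hAdet : A.det = 1 := by
    have := RingHom.map_det (C : F →+* F[X]) (Matrix.of fun i j : Fin s => (P i).coeff j)
    rw [hdet, map_one] at this
    exact this.symm
  have h1 : H.det = (A * H).det := by rw [Matrix.det_mul, hAdet, one_mul]
  rw [h1]
  refine pow_dvd_det_of_rows _ _ fun i j hi => ?_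
  rw [dvd_iff_isRoot, IsRoot.def, Matrix.mul_apply, eval_finsetSum]
  have h2 : ∀ x, ∑ l : Fin s, (P i).coeff l * x ^ (l : ℕ) = (P i).eval x := fun x => by
    rw [Fin.sum_univ_eq_sum_range (fun l => (P i).coeff l * x ^ l),
      eval_eq_sum_range' (by rw [hPd]; exact i.2)]
  calc ∑ l : Fin s, eval y (A i l * H l j)
      = ∑ l : Fin s, ∑ x, g x y * x ^ (j : ℕ) * ((P i).coeff l * x ^ (l : ℕ)) := by
        refine Finset.sum_congr rfl fun l _ => ?_
        simp only [hA, hH, Matrix.map_apply, Matrix.of_apply, eval_mul, eval_C, hM, Finset.mul_sum]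
        refine Finset.sum_congr rfl fun x _ => ?_
        ring
    _ = ∑ x, g x y * x ^ (j : ℕ) * (P i).eval x := by
        rw [Finset.sum_comm]
        refine Finset.sum_congr rfl fun x _ => ?_
        rw [← Finset.mul_sum, h2]
    _ = 0 := by
        refine Finset.sum_eq_zero fun x _ => ?_
        by_cases hx : g x y = 0
        · simp [hx]
        · have : G.eval x = 0 := by
            rw [hG, eval_prod]
            exact Finset.prod_eq_zero (i := x) (by simp [hN, hx]) (by simp)
          simp [P, hi, this]

theorem HasMoments.sum_sub_rowWt_le [Fintype F] {g : F → F → F} (hg : HasMoments g) (y₀ : F) :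
    ∑ y, (rowWt g y₀ - rowWt g y) ≤ rowWt g y₀ * (rowWt g y₀ - 1) := by
  obtain ⟨M, hM⟩ := hg
  have hev := fun k => (hM k).2
  set D := (Matrix.of fun i j : Fin (rowWt g y₀) => M (i + j)).det with hD
  have hD0 : D ≠ 0 := fun h => det_hankel_eval_ne_zero hev y₀ (by rw [← hD, h, eval_zero])
  calc ∑ y, (rowWt g y₀ - rowWt g y) ≤ ∑ y, D.roots.count y := by
        refine Finset.sum_le_sum fun y _ => ?_
        rw [count_roots, le_rootMultiplicity_iff hD0]
        exact pow_dvd_det_hankel hev y _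
    _ = Multiset.card D.roots :=
        Multiset.sum_count_eq_card fun _ _ => Finset.mem_univ _
    _ ≤ D.natDegree := card_roots' D
    _ ≤ _ := natDegree_det_hankel_le M (fun k => (hM k).1) _

theorem HasMoments.mul_le_sum_rowWt [Fintype F] {g : F → F → F} (hg : HasMoments g) (y₀ : F) :
    rowWt g y₀ * (Fintype.card F + 1 - rowWt g y₀) ≤ ∑ y, rowWt g y := by
  have h1 := hg.sum_sub_rowWt_le y₀
  set s := rowWt g y₀ with hs
  have h2 : ∑ y : F, s ≤ ∑ y, (s - rowWt g y) + ∑ y, rowWt g y := by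
    rw [← Finset.sum_add_distrib]
    exact Finset.sum_le_sum fun y _ => by omega
  rw [Finset.sum_const, Finset.card_univ, smul_eq_mul] at h2
  have h3 : s ≤ Fintype.card F := Finset.card_le_univ _
  rcases Nat.eq_zero_or_pos s with h0 | h0
  · simp [h0]
  · zify [h0, show s ≤ Fintype.card F + 1 by omega] at *
    nlinarith

end Moments

section Geometry

variable {p n : ℕ}

theorem ptIn_iff_rep {P : Pt F n} {W : Submodule F (Fin (n + 1) → F)} : ptIn P W ↔ P.rep ∈ W := by
  rw [ptIn, Projectivization.submodule_eq, Submodule.span_singleton_le_iff_mem]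

theorem ptIn_mk {v : Fin (n + 1) → F} (hv : v ≠ 0) {W : Submodule F (Fin (n + 1) → F)} :
    ptIn (Projectivization.mk F v hv) W ↔ v ∈ W := by
  rw [ptIn, Projectivization.submodule_mk, Submodule.span_singleton_le_iff_mem]

theorem wtRes_top (c : Pt F n → ZMod p) : wtRes c ⊤ = wt c := by
  rw [wtRes, wt]
  congr 1
  ext P
  simp [ptsIn, ptIn]

theorem finrank_sup_pt {U : Submodule F (Fin (n + 1) → F)} {P : Pt F n} (h : ¬ ptIn P U) :
    Module.finrank F ↥(U ⊔ P.submodule) = Module.finrank F U + 1 := by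
  have h1 := Submodule.finrank_sup_add_finrank_inf_eq U P.submodule
  have h2 : U ⊓ P.submodule = ⊥ := by
    rw [inf_comm, ← disjoint_iff]
    have h3 : IsAtom P.submodule := by
      rw [Projectivization.submodule_eq]
      exact nonzero_span_atom _ P.rep_nonzero
    exact h3.not_le_iff_disjoint.mp h
  rw [h2, finrank_bot, P.finrank_submodule] at h1
  simpa using h1

theorem sup_pt_eq_iff {U U' : Submodule F (Fin (n + 1) → F)} {P : Pt F n} (h : ¬ ptIn P U)
    (hU : U ≤ U') (hd : Module.finrank F U' = Module.finrank F U + 1) :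
    U ⊔ P.submodule = U' ↔ ptIn P U' := by
  refine ⟨fun h1 => h1 ▸ le_sup_right, fun h1 => ?_⟩
  exact Submodule.eq_of_le_of_finrank_eq (sup_le hU h1) (by rw [finrank_sup_pt h, hd])

instance instFintypePt [Fintype F] {n : ℕ} : Fintype (Pt F n) := Fintype.ofFinite _

instance instFintypeSubmodule [Fintype F] {n : ℕ} : Fintype (Submodule F (Fin (n + 1) → F)) :=
  Fintype.ofFinite _

variable [Fintype F]

theorem wtRes_eq_card (c : Pt F n → ZMod p) (W : Submodule F (Fin (n + 1) → F)) :
    wtRes c W = (Finset.univ.filter fun P => ptIn P W ∧ c P ≠ 0).card := by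
  rw [wtRes, ← Set.ncard_coe_finset]
  congr 1
  ext P
  simp [ptsIn, supp]

theorem wtRes_mono (c : Pt F n → ZMod p) {U W : Submodule F (Fin (n + 1) → F)} (h : U ≤ W) :
    wtRes c U ≤ wtRes c W := by
  rw [wtRes_eq_card, wtRes_eq_card]
  exact Finset.card_le_card fun P => by simpa using fun h1 h2 => ⟨le_trans h1 h, h2⟩

/-- The subspaces between `U` and `W` whose dimension exceeds that of `U` by one. -/
def pencil (U W : Submodule F (Fin (n + 1) → F)) : Finset (Submodule F (Fin (n + 1) → F)) :=
  Finset.univ.filter fun U' => U ≤ U' ∧ U' ≤ W ∧ Module.finrank F U' = Module.finrank F U + 1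

theorem mem_pencil {U W U' : Submodule F (Fin (n + 1) → F)} :
    U' ∈ pencil U W ↔ U ≤ U' ∧ U' ≤ W ∧ Module.finrank F U' = Module.finrank F U + 1 := by
  simp [pencil]

theorem sup_pt_mem_pencil {U W : Submodule F (Fin (n + 1) → F)} {P : Pt F n} (h : ¬ ptIn P U)
    (hU : U ≤ W) (hP : ptIn P W) : U ⊔ P.submodule ∈ pencil U W :=
  mem_pencil.mpr ⟨le_sup_left, sup_le hU hP, finrank_sup_pt h⟩

theorem wtRes_add_card_sdiff (c : Pt F n → ZMod p) {U W : Submodule F (Fin (n + 1) → F)}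
    (h : U ≤ W) :
    wtRes c W = wtRes c U +
      (Finset.univ.filter fun P => (ptIn P W ∧ c P ≠ 0) ∧ ¬ ptIn P U).card := by
  rw [wtRes_eq_card, wtRes_eq_card, ← Finset.card_filter_add_card_filter_not (fun P => ptIn P U),
    Finset.filter_filter, Finset.filter_filter]
  congr 2
  ext P
  simp only [Finset.mem_filter, Finset.mem_univ, true_and]
  exact ⟨fun h1 => ⟨h1.2, h1.1.2⟩, fun h1 => ⟨⟨le_trans h1.1 h, h1.2⟩, h1.1⟩⟩

theorem wtRes_eq_add_sum_pencil (c : Pt F n → ZMod p) {U W : Submodule F (Fin (n + 1) → F)}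
    (h : U ≤ W) :
    wtRes c W = wtRes c U + ∑ U' ∈ pencil U W, (wtRes c U' - wtRes c U) := by
  rw [wtRes_add_card_sdiff c h]
  congr 1
  rw [Finset.card_eq_sum_card_fiberwise (f := fun P => U ⊔ P.submodule) (t := pencil U W)]
  · refine Finset.sum_congr rfl fun U' hU' => ?_
    obtain ⟨h1, h2, h3⟩ := mem_pencil.mp hU'
    rw [wtRes_add_card_sdiff c h1, Nat.add_sub_cancel_left, Finset.filter_filter]
    congr 1
    ext P
    simp only [Finset.mem_filter, Finset.mem_univ, true_and]
    constructor
    · rintro ⟨⟨⟨_, h4⟩, h5⟩, h6⟩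
      exact ⟨⟨(sup_pt_eq_iff h5 h1 h3).mp h6, h4⟩, h5⟩
    · rintro ⟨⟨h4, h5⟩, h6⟩
      exact ⟨⟨⟨le_trans h4 h2, h5⟩, h6⟩, (sup_pt_eq_iff h6 h1 h3).mpr h4⟩
  · intro P hP
    simp only [Finset.coe_filter, Finset.mem_univ, true_and, Set.mem_ofPred_eq] at hP
    exact sup_pt_mem_pencil hP.2 h hP.1.1

theorem card_filter_ptIn (W : Submodule F (Fin (n + 1) → F)) :
    (Finset.univ.filter fun P : Pt F n => ptIn P W).card =
      ∑ i ∈ Finset.range (Module.finrank F W), Fintype.card F ^ i := by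
  have h1 := Projectivization.card_of_finrank F W (rfl : Module.finrank F W = _)
  rw [Nat.card_eq_fintype_card (α := F)] at h1
  rw [← h1, ← Set.ncard_coe_finset, ← Set.ncard_range_of_injective
    (Projectivization.map_injective W.subtype W.injective_subtype)]
  congr 1
  ext P
  simp only [Finset.coe_filter, Finset.mem_univ, true_and, Set.mem_ofPred_eq, Set.mem_range]
  constructor
  · intro h
    rw [ptIn_iff_rep] at h
    refine ⟨Projectivization.mk F ⟨P.rep, h⟩ fun h0 => P.rep_nonzero (congrArg Subtype.val h0), ?_⟩
    rw [Projectivization.map_mk]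
    exact P.mk_rep
  · rintro ⟨Q, rfl⟩
    induction Q using Projectivization.ind with
    | h v hv =>
      rw [Projectivization.map_mk, ptIn_mk]
      exact v.2

theorem card_pencil {U W : Submodule F (Fin (n + 1) → F)} (h : U ≤ W) {e : ℕ}
    (he : Module.finrank F W = Module.finrank F U + e) :
    (pencil U W).card = ∑ i ∈ Finset.range e, Fintype.card F ^ i := by
  have hone : ∀ U : Submodule F (Fin (n + 1) → F), wtRes (1 : Pt F n → ZMod 2) U =
      ∑ i ∈ Finset.range (Module.finrank F U), Fintype.card F ^ i := fun U => by
    rw [← card_filter_ptIn, wtRes_eq_card]; simp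
  have h1 := wtRes_eq_add_sum_pencil (1 : Pt F n → ZMod 2) h
  rw [Finset.sum_congr rfl (g := fun _ => Fintype.card F ^ Module.finrank F U)] at h1
  · rw [hone, hone, he, Finset.sum_range_add, Finset.sum_const, smul_eq_mul] at h1
    have h2 := Nat.add_left_cancel h1
    simp only [pow_add] at h2
    rw [← Finset.mul_sum, mul_comm] at h2
    exact (Nat.eq_of_mul_eq_mul_right (pow_pos Fintype.card_pos _) h2).symm
  · intro U' hU'
    rw [hone, hone, (mem_pencil.mp hU').2.2, Finset.sum_range_succ, Nat.add_sub_cancel_left]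

end Geometry

section Code

variable {p n : ℕ}

theorem exists_ker_of_finrank_lt {U W : Submodule F (Fin (n + 1) → F)} (h : U < W) :
    ∃ L : (Fin (n + 1) → F) →ₗ[F] F, U ≤ LinearMap.ker L ∧ ¬ W ≤ LinearMap.ker L ∧
      Module.finrank F (LinearMap.ker L) = n := by
  obtain ⟨v, hvW, hvU⟩ := SetLike.exists_of_lt h
  obtain ⟨L, hLv, hLU⟩ := Submodule.exists_le_ker_of_notMem hvU
  refine ⟨L, hLU, fun hW => hLv (hW hvW), ?_⟩
  have h1 := Module.Dual.finrank_ker_add_one_of_ne_zero (f := L)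
    (fun h0 => hLv (by rw [h0, LinearMap.zero_apply]))
  simpa using h1

theorem incVec_mem_code (p : ℕ) {H : Submodule F (Fin (n + 1) → F)} (hH : Module.finrank F H = n) :
    incVec p H ∈ code F p n :=
  Submodule.subset_span ⟨H, hH, rfl⟩

theorem exists_hyperplane_inter {l W : Submodule F (Fin (n + 1) → F)} (hl : IsLine l)
    (hW : IsPlane W) (hlW : l ≤ W) :
    ∃ H : Submodule F (Fin (n + 1) → F), Module.finrank F H = n ∧ H ⊓ W = l := by
  have hlt : l < W := lt_of_le_of_ne hlW fun h => by
    rw [IsPlane, ← h, hl] at hW; omega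
  obtain ⟨L, h1, h2, h3⟩ := exists_ker_of_finrank_lt hlt
  refine ⟨LinearMap.ker L, h3, ?_⟩
  refine (Submodule.eq_of_le_of_finrank_le (le_inf h1 hlW) ?_).symm
  have h4 : LinearMap.ker L ⊓ W < W := lt_of_le_of_ne inf_le_right fun h => h2 (inf_eq_right.mp h)
  have h5 := Submodule.finrank_lt_finrank_of_lt h4
  rw [hW] at h5
  rw [hl]
  omega

variable [Fintype F]

theorem wtRes_line_le {c : Pt F n → ZMod p} {l : Submodule F (Fin (n + 1) → F)} (hl : IsLine l) :
    wtRes c l ≤ Fintype.card F + 1 := by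
  have h1 := card_filter_ptIn (F := F) l
  rw [hl] at h1
  simp only [Finset.sum_range_succ, Finset.sum_range_zero, pow_zero, pow_one] at h1
  rw [wtRes_eq_card]
  refine (Finset.card_le_card (t := Finset.univ.filter fun P => ptIn P l) fun P => ?_).trans (by omega)
  simpa using fun h _ => h

theorem exists_ptIn_eq_zero {c : Pt F n → ZMod p} {l : Submodule F (Fin (n + 1) → F)}
    (hl : IsLine l) (h : wtRes c l ≤ Fintype.card F) : ∃ R : Pt F n, ptIn R l ∧ c R = 0 := by
  by_contra! hcon
  have h1 := card_filter_ptIn (F := F) l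
  rw [hl] at h1
  simp only [Finset.sum_range_succ, Finset.sum_range_zero, pow_zero, pow_one] at h1
  rw [wtRes_eq_card, Finset.filter_congr (q := fun P => ptIn P l)] at h
  · omega
  · intro P _
    exact ⟨fun h => h.1, fun h => ⟨h, hcon P h⟩⟩

theorem hasMoments_of_mem_code [CharP F p] {c : Pt F n → ZMod p} (hc : c ∈ code F p n)
    {e₀ e₁ e₂ : Fin (n + 1) → F} (he : ∀ x y : F, x • e₀ + (e₁ + y • e₂) ≠ 0) :
    HasMoments fun x y =>
      ZMod.castHom dvd_rfl F (c (Projectivization.mk F (x • e₀ + (e₁ + y • e₂)) (he x y))) := by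
  induction hc using Submodule.span_induction with
  | mem v hv =>
    obtain ⟨H, hH, rfl⟩ := hv
    obtain ⟨L, h1, _, h3⟩ := exists_ker_of_finrank_lt (U := H) (W := ⊤)
      (lt_top_iff_ne_top.mpr fun h => by rw [h, finrank_top] at hH; simp at hH)
    have hHL : H = LinearMap.ker L := Submodule.eq_of_le_of_finrank_eq h1 (by rw [hH, h3])
    convert hasMoments_one.add ((hasMoments_affine_pow (L e₀) (L e₁) (L e₂)).const_mul (-1))
      using 3 with x y
    have h4 : x * L e₀ + (L e₁ + y * L e₂) = L (x • e₀ + (e₁ + y • e₂)) := by simp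
    rw [h4, incVec]
    simp only [ptIn_mk, hHL, LinearMap.mem_ker]
    split_ifs with h5
    · rw [h5, zero_pow (Nat.sub_ne_zero_of_lt Fintype.one_lt_card)]; simp
    · rw [FiniteField.pow_card_sub_one_eq_one _ h5]; simp
  | zero => simpa using hasMoments_zero
  | add v w _ _ hv hw => simpa using hv.add hw
  | smul a v _ hv => simpa using hv.const_mul (ZMod.castHom dvd_rfl F a)

variable [Fact p.Prime]

theorem exists_lineSum (hF : p ∣ Fintype.card F) {c : Pt F n → ZMod p} (hc : c ∈ code F p n) :
    ∃ s₀ : ZMod p, ∀ l : Submodule F (Fin (n + 1) → F), IsLine l →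
      ∑ P with ptIn P l, c P = s₀ := by
  induction hc using Submodule.span_induction with
  | mem v hv =>
    obtain ⟨H, hH, rfl⟩ := hv
    refine ⟨1, fun l hl => ?_⟩
    simp only [incVec]
    rw [Finset.sum_ite, Finset.sum_const_zero, add_zero, Finset.sum_const, Finset.filter_filter,
      nsmul_eq_mul, mul_one]
    have h1 : (Finset.univ.filter fun P : Pt F n => ptIn P l ∧ ptIn P H) =
        Finset.univ.filter fun P : Pt F n => ptIn P (l ⊓ H) :=
      Finset.filter_congr fun P _ => le_inf_iff.symm
    have h0 : (Fintype.card F : ZMod p) = 0 := (ZMod.natCast_eq_zero_iff _ _).mpr hF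
    rw [h1, card_filter_ptIn]
    have h2 := Submodule.finrank_sup_add_finrank_inf_eq l H
    have h3 : Module.finrank F ↥(l ⊔ H) ≤ n + 1 := (Submodule.finrank_le _).trans (by simp)
    have h4 : Module.finrank F ↥(l ⊓ H) ≤ 2 := hl ▸ Submodule.finrank_mono inf_le_left
    rw [hl, hH] at h2
    obtain h5 | h5 : Module.finrank F ↥(l ⊓ H) = 1 ∨ Module.finrank F ↥(l ⊓ H) = 2 := by omega
    · simp [h5]
    · simp [h5, Finset.sum_range_succ, h0]
  | zero => exact ⟨0, fun l _ => by simp⟩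
  | add v w _ _ hv hw =>
    obtain ⟨a, ha⟩ := hv
    obtain ⟨b, hb⟩ := hw
    exact ⟨a + b, fun l hl => by simp [Finset.sum_add_distrib, ha l hl, hb l hl]⟩
  | smul a v _ hv =>
    obtain ⟨b, hb⟩ := hv
    exact ⟨a * b, fun l hl => by simp [← Finset.mul_sum, hb l hl]⟩

/-- An `s`-secant in a plane forces at least `s (q + 1 - s)` support points in that plane. -/
theorem mul_le_wtRes [CharP F p] {c : Pt F n → ZMod p} (hc : c ∈ code F p n)
    {l W : Submodule F (Fin (n + 1) → F)} (hl : IsLine l) (hW : IsPlane W) (hlW : l ≤ W) :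
    wtRes c l * (Fintype.card F + 1 - wtRes c l) ≤ wtRes c W := by
  by_cases hq : Fintype.card F + 1 ≤ wtRes c l
  · simp [Nat.sub_eq_zero_of_le hq]
  obtain ⟨R, hRl, hR0⟩ := exists_ptIn_eq_zero hl (c := c) (by omega)
  set e₀ := R.rep with he₀
  have hRl' := ptIn_iff_rep.mp hRl
  obtain ⟨e₁, he₁l, he₁⟩ : ∃ e₁ ∈ l, e₁ ∉ R.submodule := SetLike.exists_of_lt
    (lt_of_le_of_ne hRl fun h => by
      have := R.finrank_submodule; rw [h, hl] at this; omega)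
  obtain ⟨e₂, he₂W, he₂⟩ : ∃ e₂ ∈ W, e₂ ∉ l := SetLike.exists_of_lt
    (lt_of_le_of_ne hlW fun h => by rw [IsPlane, ← h, hl] at hW; omega)
  have hR_smul : ∀ x : F, x • e₁ ∈ R.submodule → x = 0 := fun x hx => by
    by_contra h0
    exact he₁ ((Submodule.smul_mem_iff _ h0).mp hx)
  have he₀R : ∀ x : F, x • e₀ ∈ R.submodule := fun x => Submodule.smul_mem _ _ (by
    rw [Projectivization.submodule_eq]; exact Submodule.mem_span_singleton_self _)
  -- independence of `e₀, e₁, e₂`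
  have hind : ∀ x z y : F, x • e₀ + (z • e₁ + y • e₂) = 0 → x = 0 ∧ z = 0 ∧ y = 0 := by
    intro x z y h
    have hy : y = 0 := by
      by_contra h0
      refine he₂ ((Submodule.smul_mem_iff l h0).mp ?_)
      have : y • e₂ = -(x • e₀ + z • e₁) := by
        rw [eq_neg_iff_add_eq_zero, ← h]; abel
      rw [this]
      exact l.neg_mem (l.add_mem (l.smul_mem _ hRl') (l.smul_mem _ he₁l))
    subst hy
    have hz : z = 0 := by
      refine hR_smul z ?_
      have : z • e₁ = -(x • e₀) := by
        rw [eq_neg_iff_add_eq_zero, ← h, zero_smul]; abel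
      rw [this]
      exact Submodule.neg_mem _ (he₀R x)
    subst hz
    simpa [he₀, R.rep_nonzero] using h
  have he : ∀ x y : F, x • e₀ + (e₁ + y • e₂) ≠ 0 := fun x y h => by
    have := (hind x 1 y (by rwa [one_smul])).2.1
    exact one_ne_zero this
  let pt : F → F → Pt F n := fun x y => Projectivization.mk F (x • e₀ + (e₁ + y • e₂)) (he x y)
  have hinj : ∀ x y x' y', pt x y = pt x' y' → x = x' ∧ y = y' := by
    intro x y x' y' h
    obtain ⟨a, ha⟩ := (Projectivization.mk_eq_mk_iff' F _ _ _ _).mp h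
    have h1 : (a * x' - x) • e₀ + ((a - 1) • e₁ + (a * y' - y) • e₂) = 0 := by
      rw [← sub_eq_zero] at ha
      rw [← ha]; module
    obtain ⟨h2, h3, h4⟩ := hind _ _ _ h1
    rw [sub_eq_zero] at h2 h3 h4
    rw [h3, one_mul] at h2 h4
    exact ⟨h2.symm, h4.symm⟩
  have hM := hasMoments_of_mem_code hc he
  set g : F → F → F := fun x y => ZMod.castHom dvd_rfl F (c (pt x y)) with hg
  have hg0 : ∀ x y, g x y ≠ 0 ↔ c (pt x y) ≠ 0 := fun x y => by
    rw [hg]; simp only [ne_eq, map_eq_zero]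
  have hrow : rowWt g 0 = wtRes c l := by
    rw [rowWt, wtRes_eq_card]
    refine Finset.card_bij (fun x _ => pt x 0) ?_ ?_ ?_
    · intro x hx
      simp only [Finset.mem_filter, Finset.mem_univ, true_and] at hx ⊢
      refine ⟨ptIn_mk _ |>.mpr ?_, (hg0 _ _).mp hx⟩
      rw [zero_smul, add_zero]
      exact l.add_mem (l.smul_mem _ hRl') he₁l
    · intro x _ x' _ h
      exact (hinj _ _ _ _ h).1
    · intro P hP
      simp only [Finset.mem_filter, Finset.mem_univ, true_and] at hP
      have hspan : R.submodule ⊔ F ∙ e₁ = l := by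
        have h1 := finrank_sup_pt (P := Projectivization.mk F e₁ fun h => he₁ (h ▸ zero_mem _))
          (U := R.submodule) (fun h => he₁ ((ptIn_mk _).mp h))
        rw [Projectivization.submodule_mk, R.finrank_submodule] at h1
        refine Submodule.eq_of_le_of_finrank_eq (sup_le hRl ?_) (by rw [h1, hl])
        rwa [Submodule.span_singleton_le_iff_mem]
      have hPl := ptIn_iff_rep.mp hP.1
      rw [← hspan, Projectivization.submodule_eq, Submodule.mem_sup] at hPl
      obtain ⟨u, hu, w, hw, huw⟩ := hPl
      obtain ⟨x, rfl⟩ := Submodule.mem_span_singleton.mp hu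
      obtain ⟨z, rfl⟩ := Submodule.mem_span_singleton.mp hw
      have hz : z ≠ 0 := by
        rintro rfl
        apply hP.2
        rw [← hR0]
        congr 1
        rw [← P.mk_rep, ← R.mk_rep, Projectivization.mk_eq_mk_iff']
        exact ⟨x, by rw [← huw]; simp⟩
      have hPpt : pt (z⁻¹ * x) 0 = P := by
        rw [← P.mk_rep, Projectivization.mk_eq_mk_iff']
        refine ⟨z⁻¹, ?_⟩
        rw [← huw, smul_add, smul_smul, smul_smul, inv_mul_cancel₀ hz]
        simp [he₀]
      exact ⟨z⁻¹ * x, by simpa [hg0, hPpt] using hP.2, hPpt⟩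
  have hsum : ∑ y, rowWt g y ≤ wtRes c W := by
    simp only [rowWt]
    rw [← Finset.card_sigma, wtRes_eq_card]
    refine Finset.card_le_card_of_injOn (fun a => pt a.2 a.1) ?_ ?_
    · rintro ⟨y, x⟩ hx
      simp only [Finset.coe_sigma, Set.mem_sigma_iff, Finset.coe_univ, Set.mem_univ, true_and,
        Finset.coe_filter, Finset.mem_univ, Set.mem_ofPred_eq] at hx ⊢
      refine ⟨ptIn_mk _ |>.mpr ?_, (hg0 _ _).mp hx⟩
      exact W.add_mem (W.smul_mem _ (hlW hRl')) (W.add_mem (hlW he₁l) (W.smul_mem _ he₂W))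
    · rintro ⟨y, x⟩ _ ⟨y', x'⟩ _ h
      obtain ⟨rfl, rfl⟩ := hinj _ _ _ _ h
      rfl
  rw [← hrow]
  exact (hM.mul_le_sum_rowWt 0).trans hsum

end Code

section Plane

variable {p n : ℕ}

theorem exists_pt_inter {l m W : Submodule F (Fin (n + 1) → F)} (hl : IsLine l) (hm : IsLine m)
    (hW : IsPlane W) (hlW : l ≤ W) (hmW : m ≤ W) : ∃ Q : Pt F n, ptIn Q l ∧ ptIn Q m := by
  have h1 := Submodule.finrank_sup_add_finrank_inf_eq l m
  have h2 := Submodule.finrank_mono (sup_le hlW hmW)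
  rw [hl, hm] at h1
  rw [hW] at h2
  have h3 : l ⊓ m ≠ ⊥ := fun h => by rw [h, finrank_bot] at h1; omega
  obtain ⟨v, hv, hv0⟩ := Submodule.exists_mem_ne_zero_of_ne_bot h3
  exact ⟨Projectivization.mk F v hv0, (ptIn_mk hv0).mpr hv.1, (ptIn_mk hv0).mpr hv.2⟩

theorem eq_of_ptIn_submodule {P Q : Pt F n} (h : ptIn P Q.submodule) : P = Q :=
  Projectivization.submodule_injective
    (Submodule.eq_of_le_of_finrank_eq h (by rw [P.finrank_submodule, Q.finrank_submodule]))

theorem line_eq_of_two_pts {l m : Submodule F (Fin (n + 1) → F)} (hl : IsLine l) (hm : IsLine m)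
    {P Q : Pt F n} (hPQ : P ≠ Q) (hPl : ptIn P l) (hPm : ptIn P m) (hQl : ptIn Q l)
    (hQm : ptIn Q m) : l = m := by
  have h0 : ¬ ptIn P Q.submodule := fun h => hPQ (eq_of_ptIn_submodule h)
  have hd : ∀ {k : Submodule F (Fin (n + 1) → F)}, IsLine k →
      Module.finrank F k = Module.finrank F Q.submodule + 1 := fun hk => by
    rw [hk, Q.finrank_submodule]
  rw [← (sup_pt_eq_iff h0 hQl (hd hl)).mpr hPl, ← (sup_pt_eq_iff h0 hQm (hd hm)).mpr hPm]

variable [Fintype F]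

theorem wtRes_pt_of_ne {c : Pt F n → ZMod p} {P : Pt F n} (h : c P ≠ 0) :
    wtRes c P.submodule = 1 := by
  rw [wtRes_eq_card, Finset.card_eq_one]
  refine ⟨P, ?_⟩
  ext Q
  simp only [Finset.mem_filter, Finset.mem_univ, true_and, Finset.mem_singleton]
  exact ⟨fun h' => eq_of_ptIn_submodule h'.1, fun hQ => by rw [hQ]; exact ⟨le_rfl, h⟩⟩

theorem wtRes_pt_of_eq {c : Pt F n → ZMod p} {P : Pt F n} (h : c P = 0) :
    wtRes c P.submodule = 0 := by
  rw [wtRes_eq_card, Finset.card_eq_zero, Finset.filter_eq_empty_iff]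
  rintro Q - ⟨h1, h2⟩
  exact h2 (eq_of_ptIn_submodule h1 ▸ h)

theorem one_le_wtRes {c : Pt F n → ZMod p} {P : Pt F n} {W : Submodule F (Fin (n + 1) → F)}
    (hP : ptIn P W) (h : c P ≠ 0) : 1 ≤ wtRes c W :=
  (wtRes_pt_of_ne h).symm.le.trans (wtRes_mono c hP)

theorem exists_of_wtRes_pos {c : Pt F n → ZMod p} {W : Submodule F (Fin (n + 1) → F)}
    (h : 0 < wtRes c W) : ∃ P : Pt F n, ptIn P W ∧ c P ≠ 0 := by
  rw [wtRes_eq_card] at h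
  obtain ⟨P, hP⟩ := Finset.card_pos.mp h
  exact ⟨P, by simpa using hP⟩

theorem mem_pencil_pt {P : Pt F n} {l W : Submodule F (Fin (n + 1) → F)} :
    l ∈ pencil P.submodule W ↔ ptIn P l ∧ l ≤ W ∧ IsLine l := by
  rw [mem_pencil, P.finrank_submodule]; rfl

theorem card_pencil_pt {P : Pt F n} {W : Submodule F (Fin (n + 1) → F)} (hW : IsPlane W)
    (hP : ptIn P W) : (pencil P.submodule W).card = Fintype.card F + 1 := by
  rw [card_pencil hP (e := 2) (by rw [hW, P.finrank_submodule])]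
  simp [Finset.sum_range_succ, add_comm]

theorem wtRes_eq_one_add_sum {c : Pt F n → ZMod p} {P : Pt F n}
    {W : Submodule F (Fin (n + 1) → F)} (hP : ptIn P W) (h : c P ≠ 0) :
    wtRes c W = 1 + ∑ l ∈ pencil P.submodule W, (wtRes c l - 1) := by
  rw [wtRes_eq_add_sum_pencil c hP, wtRes_pt_of_ne h]

theorem wtRes_eq_sum {c : Pt F n → ZMod p} {P : Pt F n}
    {W : Submodule F (Fin (n + 1) → F)} (hP : ptIn P W) (h : c P = 0) :
    wtRes c W = ∑ l ∈ pencil P.submodule W, wtRes c l := by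
  rw [wtRes_eq_add_sum_pencil c hP, wtRes_pt_of_eq h]; simp

theorem le_wtRes_plane {c : Pt F n → ZMod p} {P : Pt F n} {m W : Submodule F (Fin (n + 1) → F)}
    (hW : IsPlane W) (hmW : m ≤ W) (hm : IsLine m) (hP : ptIn P m) (h : c P ≠ 0) {k : ℕ}
    (hk : ∀ l, IsLine l → l ≤ W → ptIn P l → k + 1 ≤ wtRes c l) :
    wtRes c m + Fintype.card F * k ≤ wtRes c W := by
  have hPW : ptIn P W := le_trans hP hmW
  have hmem := mem_pencil_pt.mpr ⟨hP, hmW, hm⟩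
  have h1 : (Fintype.card F) * k ≤ ∑ l ∈ (pencil P.submodule W).erase m, (wtRes c l - 1) := by
    have := Finset.card_nsmul_le_sum ((pencil P.submodule W).erase m) (fun l => wtRes c l - 1) k
      fun l hl => by
        obtain ⟨h2, h3, h4⟩ := mem_pencil_pt.mp (Finset.mem_of_mem_erase hl)
        exact Nat.le_sub_of_add_le (hk l h4 h3 h2)
    rwa [Finset.card_erase_of_mem hmem, card_pencil_pt hW hPW, Nat.add_sub_cancel,
      smul_eq_mul] at this
  have h2 := one_le_wtRes hP h
  rw [wtRes_eq_one_add_sum hPW h, ← Finset.add_sum_erase _ _ hmem]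
  omega

theorem wtRes_plane_le {c : Pt F n → ZMod p} {P : Pt F n} {m W : Submodule F (Fin (n + 1) → F)}
    (hW : IsPlane W) (hmW : m ≤ W) (hm : IsLine m) (hP : ptIn P m) (h : c P ≠ 0) {k : ℕ}
    (hk : ∀ l, IsLine l → l ≤ W → ptIn P l → wtRes c l ≤ k + 1) :
    wtRes c W ≤ wtRes c m + Fintype.card F * k := by
  have hPW : ptIn P W := le_trans hP hmW
  have hmem := mem_pencil_pt.mpr ⟨hP, hmW, hm⟩
  have h1 : ∑ l ∈ (pencil P.submodule W).erase m, (wtRes c l - 1) ≤ (Fintype.card F) * k := by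
    have := Finset.sum_le_card_nsmul ((pencil P.submodule W).erase m) (fun l => wtRes c l - 1) k
      fun l hl => by
        obtain ⟨h2, h3, h4⟩ := mem_pencil_pt.mp (Finset.mem_of_mem_erase hl)
        exact Nat.sub_le_of_le_add (hk l h4 h3 h2)
    rwa [Finset.card_erase_of_mem hmem, card_pencil_pt hW hPW, Nat.add_sub_cancel,
      smul_eq_mul] at this
  have h2 := one_le_wtRes hP h
  rw [wtRes_eq_one_add_sum hPW h, ← Finset.add_sum_erase _ _ hmem]
  omega

theorem exists_line_through {P : Pt F n} {W : Submodule F (Fin (n + 1) → F)} (hW : IsPlane W)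
    (hP : ptIn P W) : ∃ l, IsLine l ∧ l ≤ W ∧ ptIn P l := by
  have h1 : 0 < (pencil P.submodule W).card := by rw [card_pencil_pt hW hP]; omega
  obtain ⟨l, hl⟩ := Finset.card_pos.mp h1
  obtain ⟨h2, h3, h4⟩ := mem_pencil_pt.mp hl
  exact ⟨l, h4, h3, h2⟩

theorem wtRes_line_le_of_zero {c : Pt F n → ZMod p} {l : Submodule F (Fin (n + 1) → F)}
    (hl : IsLine l) {R : Pt F n} (hR : ptIn R l) (h : c R = 0) : wtRes c l ≤ Fintype.card F := by
  have h1 := card_filter_ptIn (F := F) l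
  rw [hl] at h1
  simp only [Finset.sum_range_succ, Finset.sum_range_zero, pow_zero, pow_one] at h1
  have h2 : (Finset.univ.filter fun P : Pt F n => ptIn P l ∧ c P ≠ 0).card <
      (Finset.univ.filter fun P : Pt F n => ptIn P l).card := by
    refine Finset.card_lt_card (Finset.ssubset_iff_of_subset (fun P => ?_) |>.mpr ⟨R, ?_, ?_⟩)
    · simpa using fun h _ => h
    · simpa using hR
    · simp [h]
  rw [wtRes_eq_card]
  omega

theorem natCast_wtRes_mul {c : Pt F n → ZMod p} {m : Submodule F (Fin (n + 1) → F)} {v : ZMod p}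
    (hv : ∀ P, ptIn P m → c P ≠ 0 → c P = v) :
    (wtRes c m : ZMod p) * v = ∑ P with ptIn P m, c P := by
  rw [wtRes_eq_card, ← nsmul_eq_mul, ← Finset.sum_const, ← Finset.filter_filter,
    ← Finset.sum_filter_of_ne (s := Finset.univ.filter fun P => ptIn P m) (f := c)
      (p := fun P => c P ≠ 0) (fun P _ h => h)]
  refine Finset.sum_congr rfl fun P hP => ?_
  simp only [Finset.mem_filter, Finset.mem_univ, true_and] at hP
  exact (hv P hP.1 hP.2).symm

/-- A support point whose value differs from the common line sum lies on no `1`-secant. -/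
theorem two_le_wtRes {c : Pt F n → ZMod p} {s₀ : ZMod p} {l : Submodule F (Fin (n + 1) → F)}
    (hs₀ : ∑ P with ptIn P l, c P = s₀) {P : Pt F n} (hP : ptIn P l) (h : c P ≠ 0)
    (hne : c P ≠ s₀) : 2 ≤ wtRes c l := by
  by_contra! hlt
  have h1 : wtRes c l = 1 := le_antisymm (by omega) (one_le_wtRes hP h)
  rw [wtRes_eq_card, Finset.card_eq_one] at h1
  obtain ⟨Q, hQ⟩ := h1
  have hval : ∀ R, ptIn R l → c R ≠ 0 → R = Q := fun R hR hR0 => by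
    have : R ∈ ({Q} : Finset (Pt F n)) := by rw [← hQ]; simp [hR, hR0]
    simpa using this
  apply hne
  rw [← hs₀, Finset.sum_eq_single P]
  · intro R hR hRP
    by_contra hR0
    exact hRP ((hval R (by simpa using hR) hR0).trans (hval P hP h).symm)
  · intro hP'
    exact absurd (by simpa using hP) hP'

theorem dvd_wtRes_sub_one [Fact p.Prime] {c : Pt F n → ZMod p} {s₀ : ZMod p} (h0 : s₀ ≠ 0)
    {m : Submodule F (Fin (n + 1) → F)} (hs₀ : ∑ P with ptIn P m, c P = s₀)
    (hv : ∀ P, ptIn P m → c P ≠ 0 → c P = s₀) : 1 ≤ wtRes c m ∧ p ∣ wtRes c m - 1 := by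
  have h1 := natCast_wtRes_mul hv
  rw [hs₀] at h1
  have h2 : (wtRes c m : ZMod p) = 1 := mul_right_cancel₀ h0 (by rw [h1, one_mul])
  have h3 : 1 ≤ wtRes c m := Nat.one_le_iff_ne_zero.mpr fun h => by simp [h] at h2
  refine ⟨h3, (ZMod.natCast_eq_zero_iff _ _).mp ?_⟩
  rw [Nat.cast_sub h3, h2]; simp

/-- Subtracting a hyperplane that meets the plane `W` in a line on which `c` is constant on its
support complements the support on this line. -/
theorem exists_sub_line {c : Pt F n → ZMod p} (hc : c ∈ code F p n)
    {m W : Submodule F (Fin (n + 1) → F)} (hm : IsLine m) (hW : IsPlane W) (hmW : m ≤ W)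
    {v : ZMod p} (hv0 : v ≠ 0) (hv : ∀ P, ptIn P m → c P ≠ 0 → c P = v) :
    ∃ c' ∈ code F p n, wtRes c' m + wtRes c m = Fintype.card F + 1 ∧
      wtRes c' W + wtRes c m = wtRes c W + wtRes c' m ∧
      ∀ l, IsLine l → l ≤ W → l ≠ m → wtRes c' l = wtRes c l + 1 ∨ wtRes c' l + 1 = wtRes c l := by
  obtain ⟨H, hH, hHW⟩ := exists_hyperplane_inter hm hW hmW
  set c' : Pt F n → ZMod p := c - v • incVec p H with hc'
  have hin : ∀ P, ptIn P m → c' P = c P - v := fun P hP => by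
    have : ptIn P H := le_trans hP (hHW ▸ inf_le_left)
    simp [hc', incVec, this]
  have hout : ∀ P, ptIn P W → ¬ ptIn P m → c' P = c P := fun P hPW hPm => by
    have : ¬ ptIn P H := fun h => hPm (hHW ▸ le_inf h hPW)
    simp [hc', incVec, this]
  have hiff : ∀ P, ptIn P m → (c' P ≠ 0 ↔ c P = 0) := fun P hP => by
    rw [hin P hP, sub_ne_zero]
    constructor
    · intro h
      by_contra h1
      exact h (hv P hP h1)
    · intro h h1
      exact hv0 (by rw [← h1, h])
  refine ⟨c', sub_mem hc (Submodule.smul_mem _ _ (incVec_mem_code p hH)), ?_, ?_, ?_⟩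
  · have h1 := card_filter_ptIn (F := F) m
    rw [hm] at h1
    simp only [Finset.sum_range_succ, Finset.sum_range_zero, pow_zero, pow_one] at h1
    rw [← Finset.card_filter_add_card_filter_not (fun P => c P = 0), Finset.filter_filter,
      Finset.filter_filter] at h1
    rw [wtRes_eq_card, wtRes_eq_card, Finset.filter_congr (q := fun P => ptIn P m ∧ c P = 0)
      fun P _ => and_congr_right (hiff P)]
    simp only [ne_eq]
    omega
  · rw [wtRes_add_card_sdiff c hmW, wtRes_add_card_sdiff c' hmW]
    rw [Finset.filter_congr (q := fun P => (ptIn P W ∧ c P ≠ 0) ∧ ¬ ptIn P m)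
      (p := fun P => (ptIn P W ∧ c' P ≠ 0) ∧ ¬ ptIn P m)]
    · omega
    · rintro P -
      constructor
      · rintro ⟨⟨h1, h2⟩, h3⟩
        exact ⟨⟨h1, by rwa [← hout P h1 h3]⟩, h3⟩
      · rintro ⟨⟨h1, h2⟩, h3⟩
        exact ⟨⟨h1, by rwa [hout P h1 h3]⟩, h3⟩
  · intro l hl hlW hlm
    obtain ⟨Q, hQl, hQm⟩ := exists_pt_inter hl hm hW hlW hmW
    have h1 : (Finset.univ.filter fun P => (ptIn P l ∧ c' P ≠ 0) ∧ ¬ ptIn P Q.submodule) =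
        Finset.univ.filter fun P => (ptIn P l ∧ c P ≠ 0) ∧ ¬ ptIn P Q.submodule := by
      refine Finset.filter_congr fun P _ => ?_
      refine and_congr_left fun hP => and_congr_right fun hPl => ?_
      rw [hout P (le_trans hPl hlW) fun hPm => hlm (line_eq_of_two_pts hl hm
        (fun h => hP (by rw [h]; exact le_refl _)) hPl hPm hQl hQm)]
    rw [wtRes_add_card_sdiff c hQl, wtRes_add_card_sdiff c' hQl, h1]
    by_cases hQ : c Q = 0
    · left
      rw [wtRes_pt_of_eq hQ, wtRes_pt_of_ne ((hiff Q hQm).mpr hQ)]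
      omega
    · right
      rw [wtRes_pt_of_ne hQ, wtRes_pt_of_eq (not_not.mp (mt (hiff Q hQm).mp hQ))]
      omega

end Plane

section Bound

variable {p n : ℕ} [Fintype F]

theorem dvd_card (p : ℕ) [CharP F p] : p ∣ Fintype.card F :=
  (CharP.cast_eq_zero_iff F p _).mp (FiniteField.cast_card_eq_zero F)

theorem two_mul_card_le_wtRes [CharP F 2] {c : Pt F n → ZMod 2} (hc : c ∈ code F 2 n)
    (hq : 7 ≤ Fintype.card F) {m W : Submodule F (Fin (n + 1) → F)} (hm : IsLine m)
    (hW : IsPlane W) (hmW : m ≤ W) (h2 : wtRes c m = 2) : 2 * Fintype.card F ≤ wtRes c W := by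
  by_contra! hw
  have hval : ∀ l : Submodule F (Fin (n + 1) → F), ∀ P, ptIn P l → c P ≠ 0 → c P = 1 :=
    fun l P _ h => by
      generalize c P = x at h ⊢
      revert x
      decide
  obtain ⟨s₀, hs⟩ := exists_lineSum (dvd_card 2) hc
  have hs0 : s₀ = 0 := by
    rw [← hs m hm, ← natCast_wtRes_mul (hval m), h2]
    decide
  have heven : ∀ l, IsLine l → 2 ∣ wtRes c l := fun l hl => by
    have h := natCast_wtRes_mul (hval l)
    rw [hs l hl, hs0, mul_one] at h
    exact (ZMod.natCast_eq_zero_iff _ _).mp h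
  have hqe := dvd_card (F := F) 2
  have hbig : ∀ l, IsLine l → l ≤ W → 2 < wtRes c l → Fintype.card F ≤ wtRes c l :=
    fun l hl hlW hlt => by
      have h3 := mul_le_wtRes hc hl hW hlW
      have h4 := heven l hl
      by_contra! hcon
      obtain ⟨d, hd⟩ : ∃ d, Fintype.card F = wtRes c l + (d + 2) :=
        ⟨Fintype.card F - wtRes c l - 2, by omega⟩
      rw [show Fintype.card F + 1 - wtRes c l = d + 3 by omega] at h3
      obtain ⟨k, hk⟩ : ∃ k, wtRes c l = k + 4 := ⟨wtRes c l - 4, by omega⟩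
      rw [hk] at h3 hd
      nlinarith
  have h5 := mul_le_wtRes hc hm hW hmW
  obtain ⟨X, hXm, hX⟩ := exists_of_wtRes_pos (c := c) (W := m) (by omega)
  by_cases hall : ∀ l, IsLine l → l ≤ W → ptIn X l → wtRes c l ≤ 1 + 1
  · have := wtRes_plane_le hW hmW hm hXm hX hall
    rw [h2] at this h5
    omega
  · push Not at hall
    obtain ⟨l, hl, hlW, hXl, hlt⟩ := hall
    have h6 := hbig l hl hlW hlt
    have := le_wtRes_plane hW hlW hl hXl hX (k := 1) fun l' hl' _ hXl' => by
      have h7 := one_le_wtRes hXl' hX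
      have h8 := heven l' hl'
      omega
    omega

/-- The case of the planar bound in which every secant has `1`, `s` or `q + 1` points of the
support. -/
theorem le_wtRes_plane_of_trichotomy {r d : ℕ} (hr : d < r) (hd : 0 < d) (hd3 : d ≤ 3)
    (hq : Fintype.card F = r + d) {c : Pt F n → ZMod p}
    {l W : Submodule F (Fin (n + 1) → F)} (hl : IsLine l) (hW : IsPlane W) (hlW : l ≤ W)
    (h : wtRes c l = r + 1)
    (hs : ∀ m, IsLine m → m ≤ W →
      wtRes c m = 1 ∨ wtRes c m = r + 1 ∨ wtRes c m = Fintype.card F + 1) :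
    3 * Fintype.card F - 6 + (r + 1) ≤ wtRes c W := by
  by_contra! hw
  obtain ⟨R, hRl, hR⟩ := exists_ptIn_eq_zero (c := c) hl (by omega)
  have hRW := le_trans hRl hlW
  obtain ⟨b, hb⟩ : ∃ b, wtRes c W = Fintype.card F + 1 + b * r := by
    refine ⟨((pencil R.submodule W).filter fun m => wtRes c m = r + 1).card, ?_⟩
    rw [wtRes_eq_sum hRW hR, ← card_pencil_pt hW hRW, Finset.card_eq_sum_ones, ← smul_eq_mul,
      ← Finset.sum_const, Finset.sum_filter, ← Finset.sum_add_distrib]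
    refine Finset.sum_congr rfl fun m hm => ?_
    obtain ⟨hRm, hmW, hm⟩ := mem_pencil_pt.mp hm
    have h1 := wtRes_line_le_of_zero hm hRm hR
    have h2 := hs m hm hmW
    split_ifs <;> omega
  have hb2 : b ≤ 2 := by
    by_contra! hb3
    have : 3 * r ≤ b * r := Nat.mul_le_mul_right _ hb3
    omega
  let full : Pt F n → Finset (Submodule F (Fin (n + 1) → F)) := fun P =>
    (pencil P.submodule W).filter fun m => wtRes c m = Fintype.card F + 1
  have hone : ∀ P, ptIn P W → c P ≠ 0 → (full P).card = 1 := by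
    intro P hPW hP
    obtain ⟨a, ha⟩ : ∃ a, wtRes c W = 1 + (a * r + (full P).card * Fintype.card F) := by
      refine ⟨((pencil P.submodule W).filter fun m => wtRes c m = r + 1).card, ?_⟩
      rw [wtRes_eq_one_add_sum hPW hP, ← smul_eq_mul, ← smul_eq_mul,
        ← Finset.sum_const, ← Finset.sum_const, Finset.sum_filter, Finset.sum_filter,
        ← Finset.sum_add_distrib]
      congr 1
      refine Finset.sum_congr rfl fun m hm => ?_
      obtain ⟨-, hmW, hm⟩ := mem_pencil_pt.mp hm
      have h2 := hs m hm hmW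
      split_ifs <;> omega
    generalize (full P).card = e at ha ⊢
    rw [hb, hq] at ha
    obtain he | he | he | he : e = 0 ∨ e = 1 ∨ e = 2 ∨ 3 ≤ e := by omega
    · exfalso
      subst he
      obtain h1 | h1 := Nat.lt_or_ge (b + 1) a <;> nlinarith
    · exact he
    · exfalso
      subst he
      obtain h1 | h1 := Nat.lt_or_ge (a + 1) b <;> nlinarith
    · exfalso
      nlinarith
  have hfull : ∀ P, ptIn P W → c P ≠ 0 → ∃ m, ptIn P m ∧ m ≤ W ∧ IsLine m ∧
      wtRes c m = Fintype.card F + 1 := fun P hPW hP => by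
    obtain ⟨m, hm⟩ := Finset.card_pos.mp ((hone P hPW hP).symm ▸ one_pos)
    obtain ⟨h1, h2⟩ := Finset.mem_filter.mp hm
    obtain ⟨h3, h4, h5⟩ := mem_pencil_pt.mp h1
    exact ⟨m, h3, h4, h5, h2⟩
  have htwo : 1 < (Finset.univ.filter fun P => ptIn P l ∧ c P ≠ 0).card := by
    rw [← wtRes_eq_card]
    omega
  obtain ⟨P₁, hP₁, P₂, hP₂, hne⟩ := Finset.one_lt_card.mp htwo
  simp only [Finset.mem_filter, Finset.mem_univ, true_and] at hP₁ hP₂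
  obtain ⟨m₁, hPm₁, hmW₁, hm₁, hw₁⟩ := hfull P₁ (le_trans hP₁.1 hlW) hP₁.2
  obtain ⟨m₂, hPm₂, hmW₂, hm₂, hw₂⟩ := hfull P₂ (le_trans hP₂.1 hlW) hP₂.2
  obtain ⟨Q, hQ₁, hQ₂⟩ := exists_pt_inter hm₁ hm₂ hW hmW₁ hmW₂
  have hQ : c Q ≠ 0 := fun hQ => by
    have := wtRes_line_le_of_zero hm₁ hQ₁ hQ
    omega
  have heq : m₁ = m₂ := Finset.card_le_one.mp (hone Q (le_trans hQ₁ hmW₁) hQ).le _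
    (Finset.mem_filter.mpr ⟨mem_pencil_pt.mpr ⟨hQ₁, hmW₁, hm₁⟩, hw₁⟩) _
    (Finset.mem_filter.mpr ⟨mem_pencil_pt.mpr ⟨hQ₂, hmW₂, hm₂⟩, hw₂⟩)
  have hlm := line_eq_of_two_pts hl hm₁ hne hP₁.1 hPm₁ hP₂.1 (heq ▸ hPm₂)
  rw [hlm] at h
  omega

variable [Fact p.Prime] [CharP F p]

/-- The planar bound for words whose shortest secants meet the support in three points. -/
theorem le_wtRes_plane_of_three (hq7 : 7 ≤ Fintype.card F) (hq8 : Fintype.card F ≠ 8)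
    (hq9 : Fintype.card F ≠ 9) {c : Pt F n → ZMod p} (hc : c ∈ code F p n)
    {l W : Submodule F (Fin (n + 1) → F)} (hl : IsLine l) (hW : IsPlane W) (hlW : l ≤ W)
    (hs : ∀ m, IsLine m → m ≤ W → wtRes c m ≤ 1 ∨ 3 ≤ wtRes c m) (h : wtRes c l = 3) :
    3 * Fintype.card F - 3 ≤ wtRes c W := by
  by_contra! hw
  obtain ⟨s₀, hs₀⟩ := exists_lineSum (dvd_card (F := F) p) hc
  have hp : p.Prime := Fact.out
  have hpq := dvd_card (F := F) p
  have hthree : ∀ P, c P ≠ 0 → c P ≠ s₀ → ∀ m, IsLine m → m ≤ W → ptIn P m →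
      2 + 1 ≤ wtRes c m := fun P hP hne m hm hmW hPm => by
    have h1 := two_le_wtRes (hs₀ m hm) hPm hP hne
    have h2 := hs m hm hmW
    omega
  have hno : ∀ m, IsLine m → m ≤ W → wtRes c m ≤ 2 + 1 := fun m hm hmW => by
    by_contra! hk
    have hle := wtRes_line_le (c := c) hm
    have hA := mul_le_wtRes hc hm hW hmW
    have hge : Fintype.card F ≤ wtRes c m + 3 := by
      by_contra! hlt
      obtain ⟨d, hd⟩ : ∃ d, Fintype.card F = wtRes c m + (d + 4) :=
        ⟨Fintype.card F - wtRes c m - 4, by omega⟩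
      rw [show Fintype.card F + 1 - wtRes c m = d + 5 by omega] at hA
      obtain ⟨k, hk⟩ : ∃ k, wtRes c m = k + 4 := ⟨wtRes c m - 4, by omega⟩
      rw [hk] at hA hd
      have h1 : k * d + 2 * k + d ≤ 0 := by
        have h2 : (k + 4) * (d + 5) + 4 ≤ 3 * (k + 4 + (d + 4)) := by omega
        nlinarith
      have : k = 0 := by nlinarith
      have : d = 0 := by nlinarith
      omega
    have hval : ∀ P, ptIn P m → c P ≠ 0 → c P = s₀ := fun P hPm hP => by
      by_contra hne
      have := le_wtRes_plane hW hmW hm hPm hP (hthree P hP hne)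
      omega
    have hs0 : s₀ ≠ 0 := by
      obtain ⟨X, hXm, hX⟩ := exists_of_wtRes_pos (c := c) (W := m) (by omega)
      exact hval X hXm hX ▸ hX
    obtain ⟨-, hdvd⟩ := dvd_wtRes_sub_one hs0 (hs₀ m hm) hval
    obtain ⟨c', hc', h1, h2, h3⟩ := exists_sub_line hc hm hW hmW hs0 hval
    have hA' := mul_le_wtRes hc' hm hW hmW
    have hpt : p ∣ wtRes c' m := by
      have := Nat.dvd_sub hpq hdvd
      rwa [show Fintype.card F - (wtRes c m - 1) = wtRes c' m by omega] at this
    have hlm : l ≠ m := by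
      rintro rfl
      omega
    rw [show Fintype.card F + 1 - wtRes c' m = wtRes c m by omega] at hA'
    have ht : wtRes c' m ≤ 4 := by omega
    have hq7' : Fintype.card F = 7 → wtRes c' m ≠ 0 → wtRes c' m ≤ 4 → False := fun h7 h0 h4 => by
      rw [h7] at hpq
      have hp7 := (Nat.prime_dvd_prime_iff_eq hp (by norm_num)).mp hpq
      have := Nat.le_of_dvd (by omega) hpt
      omega
    obtain ht | ht | ht | ht | ht : wtRes c' m = 0 ∨ wtRes c' m = 1 ∨ wtRes c' m = 2 ∨
      wtRes c' m = 3 ∨ wtRes c' m = 4 := by omega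
    · have hB := mul_le_wtRes hc' hl hW hlW
      obtain h4 | h4 := h3 l hl hlW hlm
      · rw [h4, h] at hB
        omega
      · rw [show wtRes c' l = 2 by omega] at hB
        omega
    · rw [ht] at hpt
      exact hp.one_lt.ne' (Nat.dvd_one.mp hpt)
    · rw [ht] at hpt
      obtain rfl := (Nat.prime_dvd_prime_iff_eq hp Nat.prime_two).mp hpt
      have := two_mul_card_le_wtRes hc' hq7 hm hW hmW ht
      omega
    · rw [ht] at hA'
      exact hq7' (by omega) (by omega) (by omega)
    · rw [ht] at hA'
      exact hq7' (by omega) (by omega) (by omega)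
  obtain ⟨X, hXl, hX⟩ := exists_of_wtRes_pos (c := c) (W := l) (by omega)
  have h1 := wtRes_plane_le hW hlW hl hXl hX (k := 2) fun m hm hmW _ => hno m hm hmW
  have h2 := mul_le_wtRes hc hl hW hlW
  rw [h] at h1 h2
  have hq : Fintype.card F = 7 := by omega
  rw [hq] at hpq
  have hp7 := (Nat.prime_dvd_prime_iff_eq hp (by norm_num)).mp hpq
  have hex : ∃ P, ptIn P l ∧ c P ≠ 0 ∧ c P ≠ s₀ := by
    by_contra! hcon
    obtain ⟨-, hdvd⟩ := dvd_wtRes_sub_one (hcon X hXl hX ▸ hX) (hs₀ l hl) hcon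
    rw [h, hp7] at hdvd
    omega
  obtain ⟨P, hPl, hP, hne⟩ := hex
  have h3 := le_wtRes_plane hW hlW hl hPl hP (hthree P hP hne)
  obtain ⟨R, hRl, hR⟩ := exists_ptIn_eq_zero (c := c) hl (by omega)
  have h4 : 3 ∣ wtRes c W := by
    rw [wtRes_eq_sum (le_trans hRl hlW) hR]
    refine Finset.dvd_sum fun m hm => ?_
    obtain ⟨-, hmW, hm⟩ := mem_pencil_pt.mp hm
    have h5 := hno m hm hmW
    have h6 := hs m hm hmW
    have h7 : wtRes c m ≠ 1 := fun h7 => by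
      obtain ⟨Y, hYm, hY⟩ := exists_of_wtRes_pos (c := c) (W := m) (by omega)
      have := wtRes_plane_le hW hmW hm hYm hY (k := 2) fun m hm hmW _ => hno m hm hmW
      omega
    omega
  omega

/-- If no line of the plane `W` is a `k`-secant with `2 ≤ k < s`, but some line is an `s`-secant
with `3 ≤ s ≤ q`, then the restriction of `c` to `W` has large weight. -/
theorem le_wtRes_plane_of_secant (hq7 : 7 ≤ Fintype.card F) (hq8 : Fintype.card F ≠ 8)
    (hq9 : Fintype.card F ≠ 9) {c : Pt F n → ZMod p} (hc : c ∈ code F p n)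
    {l W : Submodule F (Fin (n + 1) → F)} (hl : IsLine l) (hW : IsPlane W) (hlW : l ≤ W) {s : ℕ}
    (hs3 : 3 ≤ s) (hsq : s ≤ Fintype.card F)
    (hs : ∀ m, IsLine m → m ≤ W → wtRes c m ≤ 1 ∨ s ≤ wtRes c m) (h : wtRes c l = s) :
    3 * Fintype.card F - 6 + s ≤ wtRes c W := by
  obtain rfl | hs4 := hs3.eq_or_lt
  · have := le_wtRes_plane_of_three hq7 hq8 hq9 hc hl hW hlW hs h
    omega
  by_contra! hw
  obtain ⟨s₀, hs₀⟩ := exists_lineSum (dvd_card (F := F) p) hc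
  have hp : p.Prime := Fact.out
  have hpq := dvd_card (F := F) p
  have hval : ∀ P, ptIn P W → c P ≠ 0 → c P = s₀ := fun P hPW hP => by
    by_contra hne
    have hall : ∀ m, IsLine m → m ≤ W → ptIn P m → s - 1 + 1 ≤ wtRes c m :=
      fun m hm hmW hPm => by
        have h1 := two_le_wtRes (hs₀ m hm) hPm hP hne
        have h2 := hs m hm hmW
        omega
    obtain ⟨m, hm, hmW, hPm⟩ := exists_line_through hW hPW
    have h1 := le_wtRes_plane hW hmW hm hPm hP hall
    have h2 := hall m hm hmW hPm
    have h3 : Fintype.card F * 3 ≤ Fintype.card F * (s - 1) := Nat.mul_le_mul_left _ (by omega)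
    omega
  have hs0 : s₀ ≠ 0 := by
    obtain ⟨X, hXl, hX⟩ := exists_of_wtRes_pos (c := c) (W := l) (by omega)
    exact hval X (le_trans hXl hlW) hX ▸ hX
  have hmod : ∀ m, IsLine m → m ≤ W → 1 ≤ wtRes c m ∧ p ∣ wtRes c m - 1 := fun m hm hmW =>
    dvd_wtRes_sub_one hs0 (hs₀ m hm) fun P hP => hval P (le_trans hP hmW)
  have hdvd := (hmod l hl hlW).2
  rw [h] at hdvd
  have hpd : p ∣ Fintype.card F - (s - 1) := Nat.dvd_sub hpq hdvd
  have hA := mul_le_wtRes hc hl hW hlW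
  obtain ⟨c', hc', h1, h2, -⟩ := exists_sub_line hc hl hW hlW hs0
    fun P hP => hval P (le_trans hP hlW)
  have hA' := mul_le_wtRes hc' hl hW hlW
  obtain ⟨d, hd⟩ : ∃ d, Fintype.card F = s + d := ⟨Fintype.card F - s, by omega⟩
  rw [h] at h1 h2
  rw [show wtRes c' l = d + 1 by omega] at hA' h2
  rw [h, show Fintype.card F + 1 - s = d + 1 by omega] at hA
  rw [show Fintype.card F + 1 - (d + 1) = s by omega] at hA'
  rw [show Fintype.card F - (s - 1) = d + 1 by omega] at hpd
  obtain hd0 | ⟨hd1, hd2⟩ | hd3 : d = 0 ∨ (1 ≤ d ∧ d ≤ 2) ∨ 3 ≤ d := by omega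
  · subst hd0
    exact hp.one_lt.ne' (Nat.dvd_one.mp hpd)
  · have hpd' : p = d + 1 := (Nat.prime_dvd_prime_iff_eq hp (by
      obtain rfl | rfl : d = 1 ∨ d = 2 := by omega
      · exact Nat.prime_two
      · exact Nat.prime_three)).mp hpd
    obtain ⟨r, rfl⟩ : ∃ r, s = r + 1 := ⟨s - 1, by omega⟩
    refine absurd (le_wtRes_plane_of_trichotomy (r := r) (d := d + 1) (by omega) (by omega)
      (by omega) (by omega) hl hW hlW h fun m hm hmW => ?_) (by omega)
    obtain ⟨h3, h4⟩ := hmod m hm hmW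
    have h5 := wtRes_line_le (c := c) hm
    obtain h6 | h6 := hs m hm hmW
    · omega
    · obtain ⟨j, hj⟩ : p ∣ wtRes c m - (r + 1) := by
        have := Nat.dvd_sub h4 hdvd
        rwa [show wtRes c m - 1 - (r + 1 - 1) = wtRes c m - (r + 1) by omega] at this
      have hj1 : j ≤ 1 := by
        by_contra! hj1
        have : p * 2 ≤ p * j := Nat.mul_le_mul_left _ hj1
        omega
      interval_cases j <;> omega
  · obtain ⟨a, rfl⟩ : ∃ a, s = a + 4 := ⟨s - 4, by omega⟩
    obtain ⟨b, rfl⟩ : ∃ b, d = b + 3 := ⟨d - 3, by omega⟩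
    have h3 : (a + 1) * b < 3 := by
      have : (a + 4) * (b + 3 + 1) + 6 < 3 * (a + 4 + (b + 3)) + (a + 4) := by omega
      linarith
    have h4 : (b + 1) * a < 3 := by
      have : (b + 3 + 1) * (a + 4) + (a + 4) + 6 <
        3 * (a + 4 + (b + 3)) + (a + 4) + (b + 3 + 1) := by omega
      linarith
    have ha : a < 3 := (Nat.le_mul_of_pos_left a b.succ_pos).trans_lt h4
    have hb : b < 3 := (Nat.le_mul_of_pos_left b a.succ_pos).trans_lt h3
    have h5 : a = 0 ∧ b = 0 := by
      interval_cases a <;> interval_cases b <;> omega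
    obtain ⟨rfl, rfl⟩ := h5
    rw [(Nat.prime_dvd_prime_iff_eq hp Nat.prime_three).mp hdvd, hd] at hpq
    omega

end Bound

/-- Lemma 18 of the paper: for a code word of weight strictly above
`θ_{n-1}` and at most `min {(3q-6)θ_{n-2}+2, B_{n,q}}`, there exists a `2`-secant to
`supp c`. -/
theorem statement7 [Fintype F] {p h q n : ℕ} [Fact p.Prime] (hh : 1 ≤ h) (hq : q = p ^ h)
    (hF : Fintype.card F = q) (hq7 : 7 ≤ q)
    (hqex : q ∉ ({8, 9, 16, 25, 27, 49} : Set ℕ)) (hn : 2 ≤ n)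
    (c : Pt F n → ZMod p) (hc : c ∈ code F p n)
    (hlow : theta q ((n : ℤ) - 1) < wt c)
    (hwt : (wt c : ℝ) ≤ min ((3 * (q : ℝ) - 6) * (theta q ((n : ℤ) - 2) : ℝ) + 2) (B n q)) :
    ∃ l : Submodule F (Fin (n + 1) → F), secant c l 2 := by
  obtain ⟨hF7, hF8, hF9⟩ : 7 ≤ Fintype.card F ∧ Fintype.card F ≠ 8 ∧ Fintype.card F ≠ 9 := by
    simp only [Set.mem_insert_iff, Set.mem_singleton_iff, not_or] at hqex
    omega
  have : CharP F p := charP_of_card_eq_prime_pow (f := h) (by rw [hF, hq])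
  by_contra! hno
  have hno : ∀ l : Submodule F (Fin (n + 1) → F), IsLine l → wtRes c l ≠ 2 :=
    fun l hl h2 => hno l ⟨hl, h2⟩
  obtain ⟨k, rfl⟩ : ∃ k, n = k + 2 := ⟨n - 2, by omega⟩
  have hθ₁ : theta q (((k + 2 : ℕ) : ℤ) - 1) = ∑ i ∈ Finset.range (k + 2), q ^ i := by
    rw [theta, if_neg (by omega), show (((k + 2 : ℕ) : ℤ) - 1).toNat + 1 = k + 2 by omega]
  have hθ₂ : theta q (((k + 2 : ℕ) : ℤ) - 2) = ∑ i ∈ Finset.range (k + 1), q ^ i := by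
    rw [theta, if_neg (by omega), show (((k + 2 : ℕ) : ℤ) - 2).toNat + 1 = k + 1 by omega]
  rw [hθ₁] at hlow
  have hwt : wt c ≤ (3 * q - 6) * (∑ i ∈ Finset.range (k + 1), q ^ i) + 2 := by
    have h1 := hwt.trans (min_le_left _ _)
    rw [hθ₂] at h1
    have h2 : ((3 * q - 6 : ℕ) : ℝ) = 3 * (q : ℝ) - 6 := by
      rw [Nat.cast_sub (by omega)]
      push_cast
      ring
    rw [← h2] at h1
    exact_mod_cast h1
  rw [← hF, ← wtRes_top] at hlow hwt
  have htop : Module.finrank F (⊤ : Submodule F (Fin (k + 2 + 1) → F)) = k + 3 := by simp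
  by_cases hex : ∃ s, (3 ≤ s ∧ s ≤ Fintype.card F) ∧
      ∃ l : Submodule F (Fin (k + 2 + 1) → F), IsLine l ∧ wtRes c l = s
  · obtain ⟨⟨hs3, hsq⟩, l, hl, hls⟩ := Nat.find_spec hex
    set s := Nat.find hex with hs
    have hmin : ∀ m, IsLine m → wtRes c m ≤ 1 ∨ s ≤ wtRes c m := fun m hm => by
      by_contra! hcon
      have h2 := hno m hm
      exact Nat.find_min hex hcon.2 ⟨⟨by omega, by omega⟩, m, hm, rfl⟩
    have h1 := Finset.card_nsmul_le_sum (pencil l ⊤) (fun W => wtRes c W - wtRes c l)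
      (3 * Fintype.card F - 6) fun W hW => by
        obtain ⟨hlW, -, hW⟩ := mem_pencil.mp hW
        rw [hl] at hW
        have := le_wtRes_plane_of_secant hF7 hF8 hF9 hc hl hW hlW hs3 hsq
          (fun m hm _ => hmin m hm) hls
        omega
    rw [card_pencil le_top (e := k + 1) (by rw [htop, hl]; omega), smul_eq_mul, mul_comm] at h1
    have h2 := wtRes_eq_add_sum_pencil c (le_top (a := l))
    omega
  · push Not at hex
    have hline : ∀ l : Submodule F (Fin (k + 2 + 1) → F), IsLine l →
        wtRes c l ≤ Fintype.card F → wtRes c l ≤ 1 := fun l hl hle => by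
      have h1 := hno l hl
      by_contra! hlt
      exact hex _ ⟨by omega, hle⟩ l hl rfl
    obtain ⟨R, hR⟩ : ∃ R, c R = 0 := by
      by_contra! hcon
      have h1 : wtRes c ⊤ = ∑ i ∈ Finset.range (k + 3), Fintype.card F ^ i := by
        have h0 := card_filter_ptIn (F := F) (⊤ : Submodule F (Fin (k + 2 + 1) → F))
        rw [htop] at h0
        rw [wtRes_eq_card, ← h0]
        simp [hcon]
      rw [h1, Finset.sum_range_succ', Finset.sum_range_succ', add_assoc] at hwt
      simp only [pow_succ, pow_zero, one_mul, mul_assoc, ← Finset.sum_mul] at hwt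
      have h2 : (3 * Fintype.card F - 6) ≤ Fintype.card F * Fintype.card F :=
        (Nat.sub_le _ _).trans (Nat.mul_le_mul_right _ (by omega))
      have h3 := Nat.mul_le_mul_left (∑ i ∈ Finset.range (k + 1), Fintype.card F ^ i) h2
      rw [mul_comm (3 * _ - 6)] at hwt
      omega
    have h1 := Finset.sum_le_card_nsmul (pencil R.submodule ⊤) (fun l => wtRes c l) 1
      fun l hl => by
        obtain ⟨hRl, -, hl⟩ := mem_pencil_pt.mp hl
        exact hline l hl (wtRes_line_le_of_zero hl hRl hR)
    rw [← wtRes_eq_sum le_top hR, card_pencil le_top (e := k + 2)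
      (by rw [htop, R.finrank_submodule]; omega), smul_eq_mul, mul_one] at h1
    omega

end PGCode
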